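/- arXiv:1803.08220 — 8 statements merged into one kernel-verified Lean document; each statement's English description precedes it below -/
import Mathlib

section
/- Assume that for every pair of distinct states j ≠ k one has ∑_{x∈𝒜} √(P(x|j) · P(x|k)) < 1. Then every complex S×S matrix B satisfying E_l(B) = B is diagonal, i.e., B_{jk} = 0 whenever j ≠ k. -/
open Matrix Finset

/-- The MPS site matrix `A^x` with entries `A^x_{kj} = √(T^x_{kj})`. -/
noncomputable def Amat {S 𝒜 : Type*} (T : 𝒜 → Matrix S S ℝ) (x : 𝒜) : Matrix S S ℂ :=
  Matrix.of fun k j => (Real.sqrt (T x k j) : ℂ)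

/-- The square root is additive on a finite family with at most one positive entry. -/
theorem sum_sqrt_eq_sqrt_sum_of_subsingleton_pos {ι : Type*} [Fintype ι] (f : ι → ℝ)
    (hf : ∀ i, 0 ≤ f i) (huniq : ∀ i j, 0 < f i → 0 < f j → i = j) :
    ∑ i, Real.sqrt (f i) = Real.sqrt (∑ i, f i) := by
  by_cases h : ∃ i, 0 < f i
  · obtain ⟨i, hi⟩ := h
    have hz : ∀ j, j ≠ i → f j = 0 := fun j hj =>
      le_antisymm (not_lt.mp fun hj' => hj (huniq j i hj' hi)) (hf j)
    rw [Fintype.sum_eq_single i hz,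
      Fintype.sum_eq_single i fun j hj => by rw [hz j hj, Real.sqrt_zero]]
  · have hz : ∀ i, f i = 0 := fun i => le_antisymm (not_lt.mp fun hi => h ⟨i, hi⟩) (hf i)
    simp [hz]

/-- A nonnegative kernel `N` that vanishes on the diagonal is zero if it is dominated by its
image under a nonnegative transfer map whose off-diagonal total weights are less than one. -/
theorem eq_zero_of_le_transfer {S 𝒜 : Type*} [Fintype S] [Fintype 𝒜]
    (s : 𝒜 → S → S → ℝ) (N : S → S → ℝ) (hN : ∀ a b, 0 ≤ N a b) (hdiag : ∀ a, N a a = 0)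
    (hweight : ∀ a b, a ≠ b → ∑ x, (∑ j, s x a j) * (∑ k, s x b k) < 1)
    (hle : ∀ j k, N j k ≤ ∑ x, ∑ b, ∑ a, s x a j * N a b * s x b k) (a b : S) :
    N a b = 0 := by
  set c : S → S → ℝ := fun a b => ∑ x, (∑ j, s x a j) * (∑ k, s x b k) with hc
  have hswap : ∑ j, ∑ k, ∑ x, ∑ b, ∑ a, s x a j * N a b * s x b k =
      ∑ a, ∑ b, N a b * c a b := by
    have hexp : ∀ a b, N a b * c a b = ∑ x, ∑ j, ∑ k, s x a j * N a b * s x b k := by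
      intro a b
      simp only [hc, Finset.sum_mul_sum]
      simp only [Finset.mul_sum]
      refine Finset.sum_congr rfl fun x _ => Finset.sum_congr rfl fun j _ =>
        Finset.sum_congr rfl fun k _ => by ring
    simp only [hexp, ← Fintype.sum_prod_type']
    let e : S × S × 𝒜 × S × S ≃ S × S × 𝒜 × S × S :=
      { toFun := fun p => (p.2.2.2.2, p.2.2.2.1, p.2.2.1, p.1, p.2.1)
        invFun := fun p => (p.2.2.2.1, p.2.2.2.2, p.2.2.1, p.2.1, p.1)
        left_inv := fun _ => rfl
        right_inv := fun _ => rfl }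
    exact Fintype.sum_equiv e _ _ fun _ => rfl
  have hsum : ∑ a, ∑ b, N a b ≤ ∑ a, ∑ b, N a b * c a b :=
    (Finset.sum_le_sum fun j _ => Finset.sum_le_sum fun k _ => hle j k).trans hswap.le
  have hnonneg : ∀ a b, 0 ≤ N a b * (1 - c a b) := by
    intro a b
    by_cases hab : a = b
    · simp [hab, hdiag]
    · exact mul_nonneg (hN a b) (sub_nonneg.mpr (hweight a b hab).le)
  have hzero : ∑ a, ∑ b, N a b * (1 - c a b) = 0 := by
    refine le_antisymm ?_ (Finset.sum_nonneg fun a _ => Finset.sum_nonneg fun b _ => hnonneg a b)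
    simp only [mul_sub, mul_one, Finset.sum_sub_distrib]
    linarith
  by_cases hab : a = b
  · rw [hab, hdiag]
  · have h1 := (Finset.sum_eq_zero_iff_of_nonneg fun a _ =>
      Finset.sum_nonneg fun b _ => hnonneg a b).mp hzero a (Finset.mem_univ a)
    have h2 := (Finset.sum_eq_zero_iff_of_nonneg fun b _ => hnonneg a b).mp h1 b
      (Finset.mem_univ b)
    exact (mul_eq_zero.mp h2).resolve_right (sub_pos.mpr (hweight a b hab)).ne'

/-- If `∑ x, √(P(x|j)·P(x|k)) < 1` for all distinct states `j ≠ k`, then every fixed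
point of the transfer map `E_l(B) = ∑ x, (A^x)† B A^x` is a diagonal matrix. -/
theorem fixed_points_diagonal
    {S 𝒜 : Type*} [Fintype S] [Fintype 𝒜] [Nonempty S] [Nonempty 𝒜] [DecidableEq S]
    (T : 𝒜 → Matrix S S ℝ)
    (hpos : ∀ x k j, 0 ≤ T x k j)
    (hnorm : ∀ k, ∑ x : 𝒜, ∑ j : S, T x k j = 1)
    (hunif : ∀ k x j j', 0 < T x k j → 0 < T x k j' → j = j')
    (hdist : ∀ j k : S, j ≠ k →
      ∑ x : 𝒜, Real.sqrt ((∑ i : S, T x j i) * (∑ i : S, T x k i)) < 1)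
    (B : Matrix S S ℂ)
    (hfix : ∑ x : 𝒜, (Amat T x)ᴴ * B * Amat T x = B) :
    ∀ j k : S, j ≠ k → B j k = 0 := by
  intro j k hjk
  have key := eq_zero_of_le_transfer (fun x a j => Real.sqrt (T x a j))
    (fun a b => if a = b then 0 else ‖B a b‖)
    (fun a b => ite_nonneg le_rfl (norm_nonneg _)) (fun a => if_pos rfl) ?_ ?_ j k
  · simpa [hjk] using key
  · intro a b hab
    refine lt_of_eq_of_lt (Finset.sum_congr rfl fun x _ => ?_) (hdist a b hab)
    rw [sum_sqrt_eq_sqrt_sum_of_subsingleton_pos _ (hpos x a) (hunif a x),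
      sum_sqrt_eq_sqrt_sum_of_subsingleton_pos _ (hpos x b) (hunif b x),
      Real.sqrt_mul (Finset.sum_nonneg fun i _ => hpos x a i)]
  · intro j k
    by_cases hjk : j = k
    · rw [if_pos hjk]
      refine Finset.sum_nonneg fun x _ => Finset.sum_nonneg fun b _ =>
        Finset.sum_nonneg fun a _ => ?_
      split_ifs <;> positivity
    · rw [if_neg hjk]
      have hent : B j k = ∑ x, ∑ b, ∑ a,
          (Real.sqrt (T x a j) : ℂ) * B a b * (Real.sqrt (T x b k) : ℂ) := by
        conv_lhs => rw [← hfix]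
        simp [Matrix.sum_apply, Matrix.mul_apply, Amat, Finset.sum_mul]
      rw [hent]
      refine norm_sum_le_of_le _ fun x _ => norm_sum_le_of_le _ fun b _ =>
        norm_sum_le_of_le _ fun a _ => ?_
      by_cases hab : a = b
      · subst hab
        have hz : Real.sqrt (T x a j) = 0 ∨ Real.sqrt (T x a k) = 0 := by
          by_contra! h
          exact hjk (hunif a x j k (Real.sqrt_ne_zero'.mp h.1) (Real.sqrt_ne_zero'.mp h.2))
        rcases hz with h | h <;> simp [h]
      · simp [hab, abs_of_nonneg (Real.sqrt_nonneg _)]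
end

section
/- The transfer map preserves diagonal matrices and acts on them as the classical Markov transition: for any complex vector p = (p_k)_{k∈S}, E_l(∑_k p_k |k⟩⟨k|) = ∑_j (∑_{k∈S} p_k M_{kj}) |j⟩⟨j|, where M_{kj} = ∑_{x∈𝒜} T^x_{kj}. -/
open Matrix Finset

/-- The transfer map `E_l(B) = ∑ x, (A^x)† B A^x` preserves diagonal matrices and
acts on them as the classical Markov transition `M_{kj} = ∑ x, T^x_{kj}`. -/
theorem transfer_map_on_diagonal
    {S 𝒜 : Type*} [Fintype S] [Fintype 𝒜] [Nonempty S] [Nonempty 𝒜] [DecidableEq S]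
    (T : 𝒜 → Matrix S S ℝ)
    (hpos : ∀ x k j, 0 ≤ T x k j)
    (hnorm : ∀ k, ∑ x : 𝒜, ∑ j : S, T x k j = 1)
    (hunif : ∀ k x j j', 0 < T x k j → 0 < T x k j' → j = j')
    (p : S → ℂ) :
    ∑ x : 𝒜, (Amat T x)ᴴ * Matrix.diagonal p * Amat T x
      = Matrix.diagonal (fun j => ∑ k : S, p k * ((∑ x : 𝒜, T x k j : ℝ) : ℂ)) := by
  ext i j
  simp only [Matrix.sum_apply, Matrix.mul_apply (M := (Amat T _)ᴴ * Matrix.diagonal p),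
    Matrix.mul_diagonal, Matrix.conjTranspose_apply]
  simp only [Amat, Matrix.of_apply, RCLike.star_def, Complex.conj_ofReal]
  rw [Finset.sum_comm, Matrix.diagonal_apply]
  split_ifs with h
  · subst h
    refine Finset.sum_congr rfl fun k _ => ?_
    rw [Complex.ofReal_sum, Finset.mul_sum]
    refine Finset.sum_congr rfl fun x _ => ?_
    rw [mul_right_comm, ← Complex.ofReal_mul, Real.mul_self_sqrt (hpos x k i), mul_comm]
  · refine Finset.sum_eq_zero fun k _ => Finset.sum_eq_zero fun x _ => ?_
    rcases (hpos x k i).eq_or_lt with hi | hi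
    · simp [← hi]
    rcases (hpos x k j).eq_or_lt with hj | hj
    · simp [← hj]
    exact absurd (hunif k x i j hi hj) h
end

section
/- Assume (i) for every pair of distinct states j ≠ k, ∑_{x∈𝒜} √(P(x|j) · P(x|k)) < 1, and (ii) the space of row vectors v ∈ ℂ^S with ∑_k v_k M_{kj} = v_j for all j is one-dimensional, where M_{kj} = ∑_{x∈𝒜} T^x_{kj}. Then the space of complex S×S matrices B with E_l(B) = B is one-dimensional; in particular, its fixed points are exactly the scalar multiples of diag(π) for any stationary distribution π. -/
open Matrix Finset

/-- The transfer map `E_l(B) = ∑ x, (A^x)† B A^x` as a linear endomorphism of the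
space of complex `S × S` matrices. -/
noncomputable def Elmap {S 𝒜 : Type*} [Fintype S] [Fintype 𝒜] (T : 𝒜 → Matrix S S ℝ) :
    Matrix S S ℂ →ₗ[ℂ] Matrix S S ℂ where
  toFun B := ∑ x : 𝒜, (Amat T x)ᴴ * B * Amat T x
  map_add' B C := by
    simp [Matrix.mul_add, Matrix.add_mul, Finset.sum_add_distrib]
  map_smul' c B := by
    simp [Matrix.mul_smul, Matrix.smul_mul, Finset.smul_sum]

theorem Elmap_apply_apply {S 𝒜 : Type*} [Fintype S] [Fintype 𝒜] (T : 𝒜 → Matrix S S ℝ)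
    (B : Matrix S S ℂ) (i j : S) :
    Elmap T B i j =
      ∑ x, ∑ l, ∑ k, (Real.sqrt (T x k i) : ℂ) * B k l * (Real.sqrt (T x l j) : ℂ) := by
  simp [Elmap, Amat, Matrix.sum_apply, Matrix.mul_apply, Finset.sum_mul]

theorem sqrt_mul_sqrt_eq_zero_of_unifilar {S 𝒜 : Type*} {T : 𝒜 → Matrix S S ℝ}
    (hpos : ∀ x k j, 0 ≤ T x k j)
    (hunif : ∀ k x j j', 0 < T x k j → 0 < T x k j' → j = j')
    (x : 𝒜) (k : S) {i j : S} (hij : i ≠ j) :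
    Real.sqrt (T x k i) * Real.sqrt (T x k j) = 0 := by
  rcases (hpos x k i).eq_or_lt with h | h
  · simp [← h]
  rcases (hpos x k j).eq_or_lt with h' | h'
  · simp [← h']
  exact absurd (hunif k x i j h h') hij

theorem sum_sqrt_of_unifilar {S 𝒜 : Type*} [Fintype S] {T : 𝒜 → Matrix S S ℝ}
    (hpos : ∀ x k j, 0 ≤ T x k j)
    (hunif : ∀ k x j j', 0 < T x k j → 0 < T x k j' → j = j') (x : 𝒜) (k : S) :
    ∑ i, Real.sqrt (T x k i) = Real.sqrt (∑ i, T x k i) := by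
  by_cases h : ∃ i, 0 < T x k i
  · obtain ⟨i, hi⟩ := h
    have hz : ∀ j, j ≠ i → T x k j = 0 := fun j hj =>
      le_antisymm (not_lt.1 fun h => hj (hunif k x j i h hi)) (hpos x k j)
    rw [Fintype.sum_eq_single i hz, Fintype.sum_eq_single i fun j hj => by simp [hz j hj]]
  · push Not at h
    have hz : ∀ j, T x k j = 0 := fun j => le_antisymm (h j) (hpos x k j)
    simp [hz]

theorem offDiag_eq_zero_of_Elmap_eq {S 𝒜 : Type*} [Fintype S] [Fintype 𝒜]
    {T : 𝒜 → Matrix S S ℝ} (hpos : ∀ x k j, 0 ≤ T x k j)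
    (hunif : ∀ k x j j', 0 < T x k j → 0 < T x k j' → j = j')
    (hdist : ∀ j k : S, j ≠ k →
      ∑ x : 𝒜, Real.sqrt ((∑ i : S, T x j i) * (∑ i : S, T x k i)) < 1)
    {B : Matrix S S ℂ} (hB : Elmap T B = B) {i j : S} (hij : i ≠ j) : B i j = 0 := by
  classical
  set N : S → S → ℝ := fun k l => if k = l then 0 else ‖B k l‖ with hN
  set D : S → S → ℝ := fun k l =>
    ∑ x, Real.sqrt ((∑ i, T x k i) * (∑ i, T x l i)) with hD
  have hN0 : ∀ k l, 0 ≤ N k l := fun k l => by simp only [hN]; split_ifs <;> positivity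
  have hle : ∀ i j, N i j ≤
      ∑ x, ∑ l, ∑ k, Real.sqrt (T x k i) * N k l * Real.sqrt (T x l j) := by
    intro i j
    by_cases hij : i = j
    · have : N i j = 0 := if_pos hij
      rw [this]
      exact sum_nonneg fun x _ => sum_nonneg fun l _ => sum_nonneg fun k _ =>
        mul_nonneg (mul_nonneg (Real.sqrt_nonneg _) (hN0 k l)) (Real.sqrt_nonneg _)
    · have : N i j = ‖Elmap T B i j‖ := by rw [hB]; exact if_neg hij
      rw [this, Elmap_apply_apply]
      refine norm_sum_le_of_le _ fun x _ => norm_sum_le_of_le _ fun l _ =>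
        norm_sum_le_of_le _ fun k _ => ?_
      rw [norm_mul, norm_mul, Complex.norm_of_nonneg (Real.sqrt_nonneg _),
        Complex.norm_of_nonneg (Real.sqrt_nonneg _)]
      by_cases hkl : k = l
      · subst hkl
        rw [mul_right_comm, sqrt_mul_sqrt_eq_zero_of_unifilar hpos hunif x k hij]
        simp [hN]
      · simp [hN, hkl]
  have hsum : ∑ k, ∑ l, N k l ≤ ∑ k, ∑ l, N k l * D k l := by
    calc ∑ i, ∑ j, N i j
        ≤ ∑ i, ∑ j, ∑ x, ∑ l, ∑ k,
            Real.sqrt (T x k i) * N k l * Real.sqrt (T x l j) :=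
          sum_le_sum fun i _ => sum_le_sum fun j _ => hle i j
      _ = ∑ x, ∑ l, ∑ k, ∑ i, ∑ j,
            Real.sqrt (T x k i) * N k l * Real.sqrt (T x l j) := by
          simp_rw [sum_comm (s := (univ : Finset S)) (t := (univ : Finset 𝒜))]
          refine sum_congr rfl fun x _ => ?_
          simp_rw [← Fintype.sum_prod_type']
          let e : (S × S × S × S) ≃ (S × S × S × S) :=
            ⟨fun p => (p.2.2.1, p.2.2.2, p.1, p.2.1),
             fun p => (p.2.2.1, p.2.2.2, p.1, p.2.1), fun _ => rfl, fun _ => rfl⟩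
          exact Fintype.sum_equiv e _ _ fun p => rfl
      _ = ∑ x, ∑ l, ∑ k, N k l * Real.sqrt ((∑ i, T x k i) * (∑ i, T x l i)) := by
          refine sum_congr rfl fun x _ => sum_congr rfl fun l _ => sum_congr rfl fun k _ => ?_
          rw [Real.sqrt_mul (sum_nonneg fun i _ => hpos x k i),
            ← sum_sqrt_of_unifilar hpos hunif, ← sum_sqrt_of_unifilar hpos hunif, sum_mul_sum,
            mul_sum]
          refine sum_congr rfl fun i _ => ?_
          rw [mul_sum]
          exact sum_congr rfl fun j _ => by ring
      _ = ∑ k, ∑ l, N k l * D k l := by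
          simp only [hD, mul_sum]
          rw [sum_comm, sum_congr rfl fun l _ => sum_comm, sum_comm]
  have hterm : ∀ k l, N k l * D k l ≤ N k l := by
    intro k l
    by_cases hkl : k = l
    · simp [hN, hkl]
    · exact mul_le_of_le_one_right (hN0 k l) (hdist k l hkl).le
  have hlt : ¬ 0 < N i j := by
    intro h
    refine absurd hsum (not_le.2 ?_)
    refine sum_lt_sum (fun k _ => sum_le_sum fun l _ => hterm k l) ⟨i, mem_univ _, ?_⟩
    exact sum_lt_sum (fun l _ => hterm i l)
      ⟨j, mem_univ _, mul_lt_of_lt_one_right h (hdist i j hij)⟩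
  simpa [hN, hij] using hlt

theorem Elmap_diagonal {S 𝒜 : Type*} [Fintype S] [Fintype 𝒜] [DecidableEq S]
    {T : 𝒜 → Matrix S S ℝ} (hpos : ∀ x k j, 0 ≤ T x k j)
    (hunif : ∀ k x j j', 0 < T x k j → 0 < T x k j' → j = j') (v : S → ℂ) :
    Elmap T (diagonal v) =
      diagonal (v ᵥ* Matrix.of fun k j => ((∑ x : 𝒜, T x k j : ℝ) : ℂ)) := by
  ext i j
  have hterm : ∀ (x : 𝒜) (l : S),
      ∑ k, (Real.sqrt (T x k i) : ℂ) * diagonal v k l * (Real.sqrt (T x l j) : ℂ) =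
        v l * ((Real.sqrt (T x l i) * Real.sqrt (T x l j) : ℝ) : ℂ) := by
    intro x l
    rw [Fintype.sum_eq_single l fun k hk => by simp [hk]]
    rw [diagonal_apply_eq]
    push_cast
    ring
  simp_rw [Elmap_apply_apply, hterm]
  by_cases hij : i = j
  · subst hij
    simp_rw [Real.mul_self_sqrt (hpos _ _ _)]
    rw [diagonal_apply_eq, sum_comm]
    simp [vecMul, dotProduct, mul_sum]
  · simp [sqrt_mul_sqrt_eq_zero_of_unifilar hpos hunif _ _ hij, hij]

/-- The fixed points of `E_l` are the diagonal matrices whose diagonal is fixed by the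
classical transition matrix. -/
theorem eqLocus_Elmap_eq_map_diagonal {S 𝒜 : Type*} [Fintype S] [Fintype 𝒜] [DecidableEq S]
    {T : 𝒜 → Matrix S S ℝ} (hpos : ∀ x k j, 0 ≤ T x k j)
    (hunif : ∀ k x j j', 0 < T x k j → 0 < T x k j' → j = j')
    (hdist : ∀ j k : S, j ≠ k →
      ∑ x : 𝒜, Real.sqrt ((∑ i : S, T x j i) * (∑ i : S, T x k i)) < 1) :
    LinearMap.eqLocus (Elmap T) LinearMap.id =
      (LinearMap.eqLocus
          (Matrix.vecMulLinear (Matrix.of fun k j => ((∑ x : 𝒜, T x k j : ℝ) : ℂ)))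
          LinearMap.id).map (diagonalLinearMap S ℂ ℂ) := by
  ext B
  simp only [LinearMap.mem_eqLocus, LinearMap.id_apply, Submodule.mem_map, vecMulLinear_apply,
    diagonalLinearMap_apply]
  constructor
  · intro hB
    have hdiag : diagonal B.diag = B := by
      ext i j
      by_cases hij : i = j
      · simp [hij]
      · rw [diagonal_apply_ne _ hij, offDiag_eq_zero_of_Elmap_eq hpos hunif hdist hB hij]
    refine ⟨B.diag, diagonal_injective ?_, hdiag⟩
    rw [← Elmap_diagonal hpos hunif, hdiag, hB]
  · rintro ⟨v, hv, rfl⟩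
    exact (Elmap_diagonal hpos hunif v).trans (congrArg diagonal hv)

/-- If `∑ x, √(P(x|j)P(x|k)) < 1` for all `j ≠ k` and the space of row vectors fixed by
the classical transition matrix `M_{kj} = ∑ x, T^x_{kj}` is one-dimensional, then the
fixed space of `E_l` is one-dimensional; in particular, the fixed points of `E_l` are
exactly the scalar multiples of `diag(π)` for any stationary distribution `π`. -/
theorem fixed_space_one_dimensional
    {S 𝒜 : Type*} [Fintype S] [Fintype 𝒜] [Nonempty S] [Nonempty 𝒜] [DecidableEq S]
    (T : 𝒜 → Matrix S S ℝ)
    (hpos : ∀ x k j, 0 ≤ T x k j)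
    (hnorm : ∀ k, ∑ x : 𝒜, ∑ j : S, T x k j = 1)
    (hunif : ∀ k x j j', 0 < T x k j → 0 < T x k j' → j = j')
    (hdist : ∀ j k : S, j ≠ k →
      ∑ x : 𝒜, Real.sqrt ((∑ i : S, T x j i) * (∑ i : S, T x k i)) < 1)
    (hMfix : Module.finrank ℂ
      ↥(LinearMap.eqLocus
          (Matrix.vecMulLinear (Matrix.of fun k j => ((∑ x : 𝒜, T x k j : ℝ) : ℂ)))
          LinearMap.id) = 1) :
    Module.finrank ℂ ↥(LinearMap.eqLocus (Elmap T) LinearMap.id) = 1 ∧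
    ∀ π : S → ℝ, (∀ k, 0 ≤ π k) → (∑ k : S, π k = 1) →
      (∀ j, ∑ k : S, ∑ x : 𝒜, π k * T x k j = π j) →
      ∀ B : Matrix S S ℂ,
        (Elmap T B = B ↔ ∃ c : ℂ, B = c • Matrix.diagonal (fun k => (π k : ℂ))) := by
  have hmap := eqLocus_Elmap_eq_map_diagonal hpos hunif hdist
  refine ⟨?_, fun π _ hπ1 hπ B => ?_⟩
  · rw [hmap, ← hMfix]
    exact (Submodule.equivMapOfInjective (diagonalLinearMap S ℂ ℂ) diagonal_injective
      _).finrank_eq.symm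
  have hmem : (fun k => (π k : ℂ)) ∈ LinearMap.eqLocus
      (Matrix.vecMulLinear (Matrix.of fun k j => ((∑ x : 𝒜, T x k j : ℝ) : ℂ)))
      LinearMap.id := by
    rw [LinearMap.mem_eqLocus, LinearMap.id_apply, vecMulLinear_apply]
    funext j
    rw [← hπ j]
    simp [vecMul, dotProduct, mul_sum]
  have hne : (⟨_, hmem⟩ : LinearMap.eqLocus
      (Matrix.vecMulLinear (Matrix.of fun k j => ((∑ x : 𝒜, T x k j : ℝ) : ℂ)))
      LinearMap.id) ≠ 0 := by
    intro h
    have h0 : ∀ k, π k = 0 := fun k => by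
      simpa using congrFun (congrArg Subtype.val h) k
    simp [h0] at hπ1
  have hB : Elmap T B = B ↔ B ∈ LinearMap.eqLocus (Elmap T) LinearMap.id := Iff.rfl
  rw [hB, hmap]
  constructor
  · rintro ⟨v, hv, rfl⟩
    obtain ⟨c, hc⟩ := (finrank_eq_one_iff_of_nonzero' _ hne).1 hMfix ⟨v, hv⟩
    refine ⟨c, ?_⟩
    rw [← diagonal_smul]
    exact congrArg diagonal (congrArg Subtype.val hc).symm
  · rintro ⟨c, rfl⟩
    exact Submodule.smul_mem _ c (Submodule.mem_map_of_mem hmem)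
end

section
/- For every word w = x₁x₂…x_L ∈ 𝒜^L (L ≥ 1) and every index pair i, n ∈ S, the matrix-product amplitude equals the square root of the word probability: (A^{x₁} A^{x₂} ⋯ A^{x_L})_{in} = √((T^{x₁} T^{x₂} ⋯ T^{x_L})_{in}). -/
open Matrix Finset

/-- If the nonnegative left factors of a finite sum of products are supported at a single index,
the square root distributes over the sum. -/
theorem sqrt_sum_mul_of_support_unique {ι : Type*} [Fintype ι] {f g : ι → ℝ}
    (hf : ∀ j, 0 ≤ f j) (hunique : ∀ j j', 0 < f j → 0 < f j' → j = j') :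
    √(∑ j, f j * g j) = ∑ j, √(f j) * √(g j) := by
  by_cases h : ∃ j, 0 < f j
  · obtain ⟨j, hj⟩ := h
    have hzero : ∀ k, k ≠ j → f k = 0 := fun k hk =>
      le_antisymm (not_lt.mp fun h => hk (hunique k j h hj)) (hf k)
    rw [Fintype.sum_eq_single j fun k hk => by simp [hzero k hk],
      Fintype.sum_eq_single j fun k hk => by simp [hzero k hk], Real.sqrt_mul hj.le]
  · have hzero : ∀ k, f k = 0 := fun k => le_antisymm (not_lt.mp fun hk => h ⟨k, hk⟩) (hf k)
    simp [hzero]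

/-- For a unifilar family of nonnegative matrices, the entrywise square root is multiplicative
along words. -/
theorem prod_map_Amat_apply {S 𝒜 : Type*} [Fintype S] [DecidableEq S]
    {T : 𝒜 → Matrix S S ℝ} (hpos : ∀ x k j, 0 ≤ T x k j)
    (hunif : ∀ k x j j', 0 < T x k j → 0 < T x k j' → j = j') (l : List 𝒜) (i n : S) :
    (l.map (Amat T)).prod i n = (√((l.map T).prod i n) : ℂ) := by
  induction l generalizing i with
  | nil => by_cases h : i = n <;> simp [h]
  | cons x l ih =>
    simp only [List.map_cons, List.prod_cons, Matrix.mul_apply, ih]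
    rw [sqrt_sum_mul_of_support_unique (hpos x i) (hunif i x)]
    simp [Amat]

/-- For every word `w = x₁…x_L` (`L ≥ 1`) and indices `i n`, the matrix-product
amplitude equals the square root of the word probability:
`(A^{x₁} ⋯ A^{x_L})_{in} = √((T^{x₁} ⋯ T^{x_L})_{in})`. -/
theorem amplitude_eq_sqrt_probability
    {S 𝒜 : Type*} [Fintype S] [Fintype 𝒜] [Nonempty S] [Nonempty 𝒜] [DecidableEq S]
    (T : 𝒜 → Matrix S S ℝ)
    (hpos : ∀ x k j, 0 ≤ T x k j)
    (hnorm : ∀ k, ∑ x : 𝒜, ∑ j : S, T x k j = 1)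
    (hunif : ∀ k x j j', 0 < T x k j → 0 < T x k j' → j = j')
    (L : ℕ) (hL : 1 ≤ L) (w : Fin L → 𝒜) (i n : S) :
    (List.ofFn fun t => Amat T (w t)).prod i n
      = (Real.sqrt ((List.ofFn fun t => T (w t)).prod i n) : ℂ) := by
  simpa only [List.map_ofFn, Function.comp_def] using
    prod_map_Amat_apply hpos hunif (List.ofFn w) i n
end

section
/- Let π be a probability vector on S and let D_π = diag(π). Let V be any complex S×S matrix all of whose diagonal entries equal 1. Then for every word w = x₁x₂…x_L ∈ 𝒜^L (L ≥ 1), writing A^w = A^{x₁} ⋯ A^{x_L} and T^w = T^{x₁} ⋯ T^{x_L}, the matrix-product-state probability equals the hidden-Markov-model word probability: Tr((A^w)^† D_π A^w V) = ∑_{i∈S} ∑_{n∈S} π_i (T^w)_{in}. -/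
open Matrix Finset

/-- The entrywise complex square root of a real matrix. -/
noncomputable def sqrtEntries {S : Type*} (M : Matrix S S ℝ) : Matrix S S ℂ :=
  M.map fun a => (Real.sqrt a : ℂ)

/-- Every row of the matrix has at most one nonzero entry. -/
def RowUnifilar {S : Type*} (M : Matrix S S ℝ) : Prop :=
  ∀ k j j', M k j ≠ 0 → M k j' ≠ 0 → j = j'

/-- A row of a row-unifilar matrix is either zero or supported at a single column. -/
lemma RowUnifilar.eq_zero_or_exists {S : Type*} {M : Matrix S S ℝ} (hM : RowUnifilar M) (k : S) :
    (∀ j, M k j = 0) ∨ ∃ m, ∀ j, j ≠ m → M k j = 0 := by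
  by_cases h : ∀ j, M k j = 0
  · exact Or.inl h
  · push Not at h
    obtain ⟨m, hm⟩ := h
    refine Or.inr ⟨m, fun j hj => ?_⟩
    by_contra hne
    exact hj (hM k j m hne hm)

lemma RowUnifilar.mul {S : Type*} [Fintype S] {M N : Matrix S S ℝ}
    (hM : RowUnifilar M) (hN : RowUnifilar N) : RowUnifilar (M * N) := by
  intro k j j' hj hj'
  rw [Matrix.mul_apply] at hj hj'
  obtain ⟨m, -, hm⟩ := Finset.exists_ne_zero_of_sum_ne_zero hj
  obtain ⟨m', -, hm'⟩ := Finset.exists_ne_zero_of_sum_ne_zero hj'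
  obtain rfl := hM k m m' (left_ne_zero_of_mul hm) (left_ne_zero_of_mul hm')
  exact hN m j j' (right_ne_zero_of_mul hm) (right_ne_zero_of_mul hm')

lemma RowUnifilar.sqrtEntries_mul {S : Type*} [Fintype S] {M N : Matrix S S ℝ}
    (hM : RowUnifilar M) (hM0 : ∀ k j, 0 ≤ M k j) :
    sqrtEntries (M * N) = sqrtEntries M * sqrtEntries N := by
  ext k j
  simp only [sqrtEntries, Matrix.map_apply, Matrix.mul_apply]
  rcases hM.eq_zero_or_exists k with h | ⟨m, h⟩
  · simp [h]
  · rw [Finset.sum_eq_single m (fun i _ hi => by simp [h i hi]) (by simp),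
      Finset.sum_eq_single m (fun i _ hi => by simp [h i hi]) (by simp),
      Real.sqrt_mul (hM0 k m), Complex.ofReal_mul]

lemma rowUnifilar_one {S : Type*} [DecidableEq S] : RowUnifilar (1 : Matrix S S ℝ) := by
  intro k j j' hj hj'
  rw [Matrix.one_apply, ne_eq, ite_eq_right_iff, Classical.not_imp] at hj hj'
  exact hj.1.symm.trans hj'.1

/-- For nonnegative row-unifilar matrices, products stay nonnegative and row-unifilar, and the
entrywise square root is multiplicative. -/
lemma list_prod_sqrtEntries {S : Type*} [Fintype S] [DecidableEq S] (l : List (Matrix S S ℝ))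
    (h0 : ∀ M ∈ l, ∀ k j, 0 ≤ M k j) (hu : ∀ M ∈ l, RowUnifilar M) :
    (∀ k j, 0 ≤ l.prod k j) ∧ RowUnifilar l.prod ∧
      (l.map sqrtEntries).prod = sqrtEntries l.prod := by
  induction l with
  | nil =>
    refine ⟨fun k j => ?_, rowUnifilar_one, ?_⟩
    · rw [List.prod_nil, Matrix.one_apply]
      split_ifs <;> norm_num
    · ext k j
      by_cases h : k = j <;> simp [sqrtEntries, h]
  | cons M l ih =>
    rw [List.forall_mem_cons] at h0 hu
    obtain ⟨ih0, ihu, ihs⟩ := ih h0.2 hu.2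
    rw [List.map_cons, List.prod_cons, List.prod_cons, ihs]
    refine ⟨fun k j => ?_, hu.1.mul ihu, (hu.1.sqrtEntries_mul h0.1).symm⟩
    rw [Matrix.mul_apply]
    exact Finset.sum_nonneg fun i _ => mul_nonneg (h0.1 k i) (ih0 i j)

/-- Conjugating a diagonal matrix by the entrywise square root of a nonnegative row-unifilar
matrix gives a diagonal matrix. -/
lemma RowUnifilar.conjTranspose_mul_diagonal_mul {S : Type*} [Fintype S] [DecidableEq S]
    {M : Matrix S S ℝ} (hM : RowUnifilar M) (hM0 : ∀ k j, 0 ≤ M k j) (d : S → ℂ) :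
    (sqrtEntries M)ᴴ * Matrix.diagonal d * sqrtEntries M =
      Matrix.diagonal fun n => ∑ i, d i * (M i n : ℂ) := by
  ext m n
  rw [Matrix.mul_apply, Matrix.diagonal_apply]
  simp only [Matrix.mul_diagonal, Matrix.conjTranspose_apply, sqrtEntries, Matrix.map_apply,
    RCLike.star_def, Complex.conj_ofReal]
  split_ifs with hmn
  · subst hmn
    refine Finset.sum_congr rfl fun i _ => ?_
    rw [mul_right_comm, ← Complex.ofReal_mul, Real.mul_self_sqrt (hM0 i m), mul_comm]
  · refine Finset.sum_eq_zero fun i _ => ?_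
    by_cases h : M i m = 0
    · simp [h]
    · have h' : M i n = 0 := by
        by_contra hne
        exact hmn (hM i m n h hne)
      simp [h']

/-- For a probability vector `π` with `D_π = diag(π)` and any matrix `V` whose diagonal
entries are all `1`, and any word `w = x₁…x_L` with `L ≥ 1`, the MPS probability equals
the HMM word probability: `Tr((A^w)† D_π A^w V) = ∑ i n, π_i (T^w)_{in}`. -/
theorem mps_probability_eq_hmm_probability
    {S 𝒜 : Type*} [Fintype S] [Fintype 𝒜] [Nonempty S] [Nonempty 𝒜] [DecidableEq S]
    (T : 𝒜 → Matrix S S ℝ)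
    (hpos : ∀ x k j, 0 ≤ T x k j)
    (hnorm : ∀ k, ∑ x : 𝒜, ∑ j : S, T x k j = 1)
    (hunif : ∀ k x j j', 0 < T x k j → 0 < T x k j' → j = j')
    (π : S → ℝ) (hπ0 : ∀ k, 0 ≤ π k) (hπ1 : ∑ k : S, π k = 1)
    (V : Matrix S S ℂ) (hV : ∀ k, V k k = 1)
    (L : ℕ) (hL : 1 ≤ L) (w : Fin L → 𝒜) :
    Matrix.trace
        (((List.ofFn fun t => Amat T (w t)).prod)ᴴ
          * Matrix.diagonal (fun k => (π k : ℂ))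
          * (List.ofFn fun t => Amat T (w t)).prod * V)
      = ∑ i : S, ∑ n : S, (π i : ℂ) * (((List.ofFn fun t => T (w t)).prod i n : ℝ) : ℂ) := by
  have hmap : (List.ofFn fun t => Amat T (w t)) =
      (List.ofFn fun t => T (w t)).map sqrtEntries := by
    rw [List.map_ofFn]
    rfl
  obtain ⟨h0, hu, hs⟩ := list_prod_sqrtEntries (List.ofFn fun t => T (w t))
    (by
      rw [List.forall_mem_ofFn_iff]
      exact fun t => hpos (w t))
    (by
      rw [List.forall_mem_ofFn_iff]
      exact fun t k j j' hj hj' => hunif k (w t) j j' ((hpos _ _ _).lt_of_ne' hj)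
        ((hpos _ _ _).lt_of_ne' hj'))
  rw [hmap, hs, hu.conjTranspose_mul_diagonal_mul h0, Finset.sum_comm]
  simp only [Matrix.trace, Matrix.diag_apply, Matrix.diagonal_mul, hV, mul_one]
end

section
/- Let (A^x)_{x∈𝒜} be complex S×S matrices (S, 𝒜 finite nonempty types) and let V be a positive-semidefinite S×S matrix satisfying ∑_{x∈𝒜} A^x V (A^x)^† = V. Then for every x ∈ 𝒜, the matrix A^x maps the range of V into the range of V: A^x(range V) ⊆ range V. (Interpretation: each site matrix of the iMPS preserves the memory Hilbert space of the q-simulator.) -/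
open Matrix Finset
open scoped ComplexOrder

/-- A vector orthogonal to the kernel of a Hermitian matrix lies in its range. -/
theorem Matrix.IsHermitian.mem_range_mulVecLin_of_forall_ker
    {S : Type*} [Fintype S] {V : Matrix S S ℂ} (hV : V.IsHermitian)
    {u : S → ℂ} (hu : ∀ v, V *ᵥ v = 0 → star v ⬝ᵥ u = 0) :
    u ∈ LinearMap.range V.mulVecLin := by
  classical
  by_contra hmem
  obtain ⟨f, hfu, hf⟩ := Submodule.exists_le_ker_of_notMem hmem
  obtain ⟨w, rfl⟩ := (dotProductEquiv ℂ S).surjective f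
  refine hfu ?_
  have hw : w ᵥ* V = 0 := by
    refine dotProduct_eq_zero _ fun y => ?_
    rw [← dotProduct_mulVec]
    exact hf ⟨y, rfl⟩
  have hker : V *ᵥ star w = 0 := by
    rw [← hV.eq, ← star_vecMul, hw, star_zero]
  simpa using hu _ hker

/-- If a finite sum of the matrices `A x * V * (A x)ᴴ` with `V` positive semidefinite kills `v`,
then `V` kills each `(A x)ᴴ *ᵥ v`. -/
theorem Matrix.PosSemidef.mulVec_conjTranspose_mulVec_eq_zero
    {S 𝒜 : Type*} [Fintype S] [Fintype 𝒜] {A : 𝒜 → Matrix S S ℂ} {V : Matrix S S ℂ}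
    (hV : V.PosSemidef) {v : S → ℂ} (hv : (∑ x, A x * V * (A x)ᴴ) *ᵥ v = 0) (x : 𝒜) :
    V *ᵥ ((A x)ᴴ *ᵥ v) = 0 := by
  have hsum : ∑ y, star v ⬝ᵥ ((A y * V * (A y)ᴴ) *ᵥ v) = 0 := by
    rw [← dotProduct_sum, ← sum_mulVec, hv, dotProduct_zero]
  have hx := (Finset.sum_eq_zero_iff_of_nonneg fun y _ =>
    (hV.mul_mul_conjTranspose_same (A y)).dotProduct_mulVec_nonneg v).1 hsum x (mem_univ x)
  rw [← hV.dotProduct_mulVec_zero_iff, star_mulVec, conjTranspose_conjTranspose,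
    ← dotProduct_mulVec, mulVec_mulVec, mulVec_mulVec]
  exact hx

/-- If `V` is positive semidefinite and `∑ x, A^x V (A^x)† = V`, then each `A^x` maps
the range of `V` into the range of `V`: each site matrix of the iMPS preserves the
memory Hilbert space of the q-simulator. -/
theorem site_matrices_preserve_range
    {S 𝒜 : Type*} [Fintype S] [Fintype 𝒜] [Nonempty S] [Nonempty 𝒜] [DecidableEq S]
    (A : 𝒜 → Matrix S S ℂ) (V : Matrix S S ℂ)
    (hV : V.PosSemidef)
    (hfix : ∑ x : 𝒜, A x * V * (A x)ᴴ = V) :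
    ∀ x : 𝒜, ∀ u ∈ LinearMap.range V.mulVecLin,
      (A x).mulVec u ∈ LinearMap.range V.mulVecLin := by
  rintro x _ ⟨y, rfl⟩
  refine hV.isHermitian.mem_range_mulVecLin_of_forall_ker fun v hv => ?_
  have hker := hV.mulVec_conjTranspose_mulVec_eq_zero (A := A) (by rw [hfix, hv]) x
  have hzero : star v ᵥ* A x ᵥ* V = 0 := by
    have h := congrArg star hker
    rwa [star_mulVec, star_mulVec, conjTranspose_conjTranspose, hV.isHermitian.eq,
      star_zero] at h
  rw [mulVecLin_apply, dotProduct_mulVec, dotProduct_mulVec, hzero, zero_dotProduct]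
end

section
/- Let V be a positive-definite complex S×S matrix with all diagonal entries equal to 1 satisfying ∑_{x∈𝒜} A^x V (A^x)^† = V, let W be an invertible matrix with W W^† = V, and define σ_j = W^† e_j and B^x = W^{-1} A^x W. Then for every k ∈ S and x ∈ 𝒜, the squared norm of the post-measurement memory state gives the correct output statistics: ‖(B^x)^† σ_k‖² = ∑_{j∈S} T^x_{kj} = P(x|k). -/
open Matrix Finset
open scoped ComplexOrder

/-- For a row of `A^x`, products of entries in different columns vanish by unifilarity. -/
theorem Amat_mul_Amat {S 𝒜 : Type*} [DecidableEq S] (T : 𝒜 → Matrix S S ℝ)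
    (hpos : ∀ x k j, 0 ≤ T x k j)
    (hunif : ∀ k x j j', 0 < T x k j → 0 < T x k j' → j = j') (x : 𝒜) (k i j : S) :
    Amat T x k i * Amat T x k j = if i = j then (T x k i : ℂ) else 0 := by
  simp only [Amat, Matrix.of_apply]
  split_ifs with h
  · subst h
    rw [← Complex.ofReal_mul, Real.mul_self_sqrt (hpos x k i)]
  · rcases (hpos x k i).eq_or_lt with hi | hi
    · simp [← hi]
    · rcases (hpos x k j).eq_or_lt with hj | hj
      · simp [← hj]
      · exact absurd (hunif k x i j hi hj) h

/-- If `V` has unit diagonal, the diagonal of `A^x V (A^x)†` gives the output probabilities. -/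
theorem Amat_mul_mul_conjTranspose_diag {S 𝒜 : Type*} [Fintype S] (T : 𝒜 → Matrix S S ℝ)
    (hpos : ∀ x k j, 0 ≤ T x k j)
    (hunif : ∀ k x j j', 0 < T x k j → 0 < T x k j' → j = j')
    (V : Matrix S S ℂ) (hdiag : ∀ k, V k k = 1) (x : 𝒜) (k : S) :
    (Amat T x * V * (Amat T x)ᴴ) k k = ((∑ j, T x k j : ℝ) : ℂ) := by
  classical
  have hstar : ∀ j, star (Amat T x k j) = Amat T x k j := fun j => Complex.conj_ofReal _
  simp only [Matrix.mul_apply, Matrix.conjTranspose_apply, hstar, Finset.sum_mul]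
  push_cast
  refine Finset.sum_congr rfl fun j _ => ?_
  have h : ∀ i, Amat T x k i * V i j * Amat T x k j
      = if i = j then (T x k i : ℂ) * V i j else 0 := fun i => by
    rw [mul_right_comm, Amat_mul_Amat T hpos hunif, ite_mul, zero_mul]
  simp [h, hdiag]

/-- The squared norm of `M† e_k` is the `k`-th diagonal entry of `M M†`. -/
theorem norm_sq_conjTranspose_mulVec_single {m n : Type*} [Fintype m] [Fintype n] [DecidableEq m]
    (M : Matrix m n ℂ) (k : m) :
    ((‖(WithLp.equiv 2 (n → ℂ)).symm (Mᴴ.mulVec (Pi.single k 1))‖ ^ 2 : ℝ) : ℂ)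
      = (M * Mᴴ) k k := by
  rw [EuclideanSpace.norm_sq_eq]
  simp [Matrix.mul_apply, Complex.mul_conj']

/-- With `V` positive definite, all of whose diagonal entries equal `1`, satisfying
`∑ x, A^x V (A^x)† = V`, `W` invertible with `W W† = V`, `σ_j = W† e_j`, and
`B^x = W⁻¹ A^x W`, the squared (Euclidean) norm of the post-measurement memory state
gives the correct output statistics: `‖(B^x)† σ_k‖² = ∑ j, T^x_{kj} = P(x|k)`. -/
theorem q_simulator_correct_statistics
    {S 𝒜 : Type*} [Fintype S] [Fintype 𝒜] [Nonempty S] [Nonempty 𝒜] [DecidableEq S]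
    (T : 𝒜 → Matrix S S ℝ)
    (hpos : ∀ x k j, 0 ≤ T x k j)
    (hnorm : ∀ k, ∑ x : 𝒜, ∑ j : S, T x k j = 1)
    (hunif : ∀ k x j j', 0 < T x k j → 0 < T x k j' → j = j')
    (V W : Matrix S S ℂ)
    (hV : V.PosDef) (hdiag : ∀ k, V k k = 1)
    (hfix : ∑ x : 𝒜, Amat T x * V * (Amat T x)ᴴ = V)
    [Invertible W] (hW : W * Wᴴ = V) :
    ∀ (k : S) (x : 𝒜),
      ‖(WithLp.equiv 2 (S → ℂ)).symm
          (((W⁻¹ * Amat T x * W)ᴴ).mulVec (Wᴴ.mulVec (Pi.single k 1)))‖ ^ 2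
        = ∑ j : S, T x k j := by
  intro k x
  have hM : (W⁻¹ * Amat T x * W)ᴴ.mulVec (Wᴴ.mulVec (Pi.single k 1))
      = (Amat T x * W)ᴴ.mulVec (Pi.single k 1) := by
    rw [Matrix.mulVec_mulVec, ← Matrix.conjTranspose_mul, Matrix.mul_assoc W⁻¹,
      Matrix.mul_inv_cancel_left_of_invertible]
  rw [hM]
  apply Complex.ofReal_injective
  rw [norm_sq_conjTranspose_mulVec_single, ← Amat_mul_mul_conjTranspose_diag T hpos hunif V hdiag,
    ← hW, Matrix.conjTranspose_mul]
  simp only [Matrix.mul_assoc]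
end

section
/- Fix an integer N ≥ 1 and index states by k ∈ {0, 1, …, N−1}. Define the renewal-process site matrices A⁰ and A¹ on ℂ^N by A⁰_{k,k+1} = √((N−k−1)/(N−k)) for 0 ≤ k ≤ N−2 and A¹_{k,0} = √(1/(N−k)) for 0 ≤ k ≤ N−1, with all other entries zero. Define the internal states σ_k = (1/√(N−k)) ∑_{j=k}^{N−1} e_j, whose Gram matrix has entries G_{kj} = ⟨σ_k, σ_j⟩ = (N − max(k,j))/√((N−k)(N−j)). Then G is a fixed point of the transfer map: A⁰ G (A⁰)^† + A¹ G (A¹)^† = G. -/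
open Matrix Finset

/-- Renewal-process site matrix `A⁰` with `A⁰_{k,k+1} = √((N−k−1)/(N−k))`. -/
noncomputable def renewalA0 (N : ℕ) : Matrix (Fin N) (Fin N) ℂ :=
  Matrix.of fun k j =>
    if (j : ℕ) = (k : ℕ) + 1 then
      (Real.sqrt ((((N : ℝ) - (k : ℕ)) - 1) / ((N : ℝ) - (k : ℕ))) : ℂ)
    else 0

/-- Renewal-process site matrix `A¹` with `A¹_{k,0} = √(1/(N−k))`. -/
noncomputable def renewalA1 (N : ℕ) : Matrix (Fin N) (Fin N) ℂ :=
  Matrix.of fun k j =>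
    if (j : ℕ) = 0 then (Real.sqrt (1 / ((N : ℝ) - (k : ℕ))) : ℂ) else 0

/-- Renewal-process internal state `σ_k = (1/√(N−k)) ∑_{j=k}^{N−1} e_j`. -/
noncomputable def renewalSigma (N : ℕ) (k : Fin N) : Fin N → ℂ :=
  fun j => if k ≤ j then ((1 / Real.sqrt ((N : ℝ) - (k : ℕ))) : ℂ) else 0

/-- The Gram matrix `G_{kj} = ⟨σ_k, σ_j⟩` of the renewal-process internal states. -/
noncomputable def renewalGram (N : ℕ) : Matrix (Fin N) (Fin N) ℂ :=
  Matrix.of fun k j => ∑ i : Fin N, starRingEnd ℂ (renewalSigma N k i) * renewalSigma N j i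

theorem renewalGram_apply (N : ℕ) (k j : Fin N) :
    renewalGram N k j = ((((N : ℝ) - (max (k : ℕ) (j : ℕ) : ℕ)) /
      (Real.sqrt ((N : ℝ) - (k : ℕ)) * Real.sqrt ((N : ℝ) - (j : ℕ))) : ℝ) : ℂ) := by
  have hcard : (Finset.univ.filter fun i : Fin N => k ≤ i ∧ j ≤ i).card
      = N - max (k : ℕ) (j : ℕ) := by
    have : (Finset.univ.filter fun i : Fin N => k ≤ i ∧ j ≤ i) = Finset.Ici (max k j) := by
      ext i; simp
    rw [this, Fin.card_Ici, Fin.coe_max]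
  have hterm : ∀ i : Fin N, starRingEnd ℂ (renewalSigma N k i) * renewalSigma N j i
      = if k ≤ i ∧ j ≤ i then ((1 / (Real.sqrt ((N : ℝ) - (k : ℕ)) *
          Real.sqrt ((N : ℝ) - (j : ℕ))) : ℝ) : ℂ) else 0 := by
    intro i
    by_cases hk : k ≤ i <;> by_cases hj : j ≤ i <;>
      simp [renewalSigma, hk, hj, mul_comm]
  have hle : max (k : ℕ) (j : ℕ) ≤ N := max_le k.2.le j.2.le
  simp only [renewalGram, Matrix.of_apply, hterm]
  rw [← Finset.sum_filter, Finset.sum_const, hcard, nsmul_eq_mul, Nat.cast_sub hle,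
    ← Complex.ofReal_natCast, ← Complex.ofReal_natCast, ← Complex.ofReal_sub,
    ← Complex.ofReal_mul, mul_one_div]

theorem renewalA0_mul_apply_of_lt {N : ℕ} (M : Matrix (Fin N) (Fin N) ℂ) {k : Fin N}
    (hk : (k : ℕ) + 1 < N) (j : Fin N) :
    (renewalA0 N * M) k j
      = (Real.sqrt ((((N : ℝ) - (k : ℕ)) - 1) / ((N : ℝ) - (k : ℕ))) : ℂ)
        * M ⟨(k : ℕ) + 1, hk⟩ j := by
  rw [Matrix.mul_apply, Finset.sum_eq_single ⟨(k : ℕ) + 1, hk⟩]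
  · simp [renewalA0]
  · intro b _ hb
    have : (b : ℕ) ≠ (k : ℕ) + 1 := fun h => hb (Fin.ext h)
    simp [renewalA0, this]
  · simp

theorem renewalA0_mul_apply_of_not_lt {N : ℕ} (M : Matrix (Fin N) (Fin N) ℂ) {k : Fin N}
    (hk : ¬ (k : ℕ) + 1 < N) (j : Fin N) : (renewalA0 N * M) k j = 0 := by
  rw [Matrix.mul_apply]
  refine Finset.sum_eq_zero fun b _ => ?_
  have : (b : ℕ) ≠ (k : ℕ) + 1 := by omega
  simp [renewalA0, this]

theorem renewalA1_mul_apply {N : ℕ} (hN : 0 < N) (M : Matrix (Fin N) (Fin N) ℂ)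
    (k j : Fin N) :
    (renewalA1 N * M) k j = (Real.sqrt (1 / ((N : ℝ) - (k : ℕ))) : ℂ) * M ⟨0, hN⟩ j := by
  rw [Matrix.mul_apply, Finset.sum_eq_single ⟨0, hN⟩]
  · simp [renewalA1]
  · intro b _ hb
    have : (b : ℕ) ≠ 0 := fun h => hb (Fin.ext h)
    simp [renewalA1, this]
  · simp

theorem mul_mul_conjTranspose_apply {n : Type*} [Fintype n] (A M : Matrix n n ℂ) (k j : n) :
    (A * M * Aᴴ) k j = star ((A * (A * M).conjTranspose) j k) := by
  rw [← Matrix.conjTranspose_apply, Matrix.conjTranspose_mul, Matrix.conjTranspose_conjTranspose]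

theorem renewalA0_transfer_gram_apply (N : ℕ) (k j : Fin N) :
    (renewalA0 N * renewalGram N * (renewalA0 N)ᴴ) k j
      = ((((N : ℝ) - (max (k : ℕ) (j : ℕ) : ℕ) - 1) /
        (Real.sqrt ((N : ℝ) - (k : ℕ)) * Real.sqrt ((N : ℝ) - (j : ℕ))) : ℝ) : ℂ) := by
  rw [mul_mul_conjTranspose_apply]
  by_cases hj : (j : ℕ) + 1 < N
  · rw [renewalA0_mul_apply_of_lt _ hj, Matrix.conjTranspose_apply]
    by_cases hk : (k : ℕ) + 1 < N
    · rw [renewalA0_mul_apply_of_lt _ hk, renewalGram_apply]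
      have hk' : (0 : ℝ) < (N : ℝ) - (k : ℕ) - 1 := by
        have : ((k : ℕ) : ℝ) + 1 < N := by exact_mod_cast hk
        linarith
      have hj' : (0 : ℝ) < (N : ℝ) - (j : ℕ) - 1 := by
        have : ((j : ℕ) : ℝ) + 1 < N := by exact_mod_cast hj
        linarith
      simp only [star_mul', Complex.star_def, Complex.conj_ofReal]
      rw [← Complex.ofReal_mul, ← Complex.ofReal_mul, Complex.ofReal_inj,
        Real.sqrt_div hk'.le, Real.sqrt_div hj'.le, Nat.add_max_add_right]
      push_cast
      simp only [← sub_sub]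
      have h1 := (Real.sqrt_pos.2 hk').ne'
      have h2 := (Real.sqrt_pos.2 hj').ne'
      have h3 := (Real.sqrt_pos.2 (show (0 : ℝ) < (N : ℝ) - (k : ℕ) by linarith)).ne'
      have h4 := (Real.sqrt_pos.2 (show (0 : ℝ) < (N : ℝ) - (j : ℕ) by linarith)).ne'
      field_simp
    · rw [renewalA0_mul_apply_of_not_lt _ hk]
      have h : N = max (k : ℕ) (j : ℕ) + 1 := by omega
      have h' : (N : ℝ) - (max (k : ℕ) (j : ℕ) : ℕ) - 1 = 0 := by
        rw [sub_sub, sub_eq_zero]; exact_mod_cast h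
      rw [h']
      simp
  · rw [renewalA0_mul_apply_of_not_lt _ hj]
    have h : N = max (k : ℕ) (j : ℕ) + 1 := by omega
    have h' : (N : ℝ) - (max (k : ℕ) (j : ℕ) : ℕ) - 1 = 0 := by
      rw [sub_sub, sub_eq_zero]; exact_mod_cast h
    rw [h']
    simp

theorem renewalA1_transfer_gram_apply (N : ℕ) (k j : Fin N) :
    (renewalA1 N * renewalGram N * (renewalA1 N)ᴴ) k j
      = ((1 / (Real.sqrt ((N : ℝ) - (k : ℕ)) * Real.sqrt ((N : ℝ) - (j : ℕ))) : ℝ) : ℂ) := by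
  have hN : 0 < N := k.pos
  have hN' : (N : ℝ) ≠ 0 := by exact_mod_cast hN.ne'
  rw [mul_mul_conjTranspose_apply, renewalA1_mul_apply hN, Matrix.conjTranspose_apply,
    renewalA1_mul_apply hN, renewalGram_apply]
  simp only [star_mul', Complex.star_def, Complex.conj_ofReal]
  rw [← Complex.ofReal_mul, ← Complex.ofReal_mul, Complex.ofReal_inj]
  simp [hN', mul_comm]

/-- For the discrete renewal process: the Gram matrix of the internal states has entries
`G_{kj} = (N − max(k,j)) / √((N−k)(N−j))`, and `G` is a fixed point of the transfer map
`E_r`: `A⁰ G (A⁰)† + A¹ G (A¹)† = G`. -/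
theorem renewal_gram_fixed_point (N : ℕ) (hN : 1 ≤ N) :
    (∀ k j : Fin N,
      renewalGram N k j
        = ((((N : ℝ) - (max (k : ℕ) (j : ℕ))) /
            Real.sqrt (((N : ℝ) - (k : ℕ)) * ((N : ℝ) - (j : ℕ)))) : ℂ)) ∧
    renewalA0 N * renewalGram N * (renewalA0 N)ᴴ
      + renewalA1 N * renewalGram N * (renewalA1 N)ᴴ = renewalGram N := by
  refine ⟨fun k j => ?_, ?_⟩
  · have hk : (0 : ℝ) ≤ (N : ℝ) - (k : ℕ) := sub_nonneg.2 (by exact_mod_cast k.2.le)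
    rw [renewalGram_apply, Real.sqrt_mul hk]
    simp only [Complex.ofReal_div, Complex.ofReal_sub, Complex.ofReal_mul,
      Complex.ofReal_natCast]
  · ext k j
    rw [Matrix.add_apply, renewalA0_transfer_gram_apply, renewalA1_transfer_gram_apply,
      renewalGram_apply, ← Complex.ofReal_add, ← add_div, sub_add_cancel]
end
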